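/- arXiv:2304.06158 — 4 statements merged into one kernel-verified Lean document; each statement's English description precedes it below -/
import Mathlib

section
/- Let m ≥ 1 be an integer, δ, α ∈ (0,1), and ε = sqrt(ln(2/δ)/(2m)). Let s_1 < s_2 < ⋯ < s_m be distinct real numbers, and define the empirical CDF F̂(t) = (1/m)·#{i : s_i ≤ t}, the lower band ℓ(t) = F̂(t) − ε and the upper band u(t) = F̂(t) + ε. Suppose there exists j ∈ {1,…,m} with j/m ≥ 1 − α + ε, and let j_α be the smallest such j. Then with Q = s_{j_α}, the quantity R := (ℓ(Q) − (1−α)) + (u(Q) − ℓ(Q)) satisfies R ≤ sqrt(2·ln(2/δ)/m) + 1/m. -/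
/-- Exactly `k + 1` values of a strictly monotone finite sequence are at most its `k`-th one. -/
lemma StrictMono.card_filter_le_apply {m : ℕ} {β : Type*} [LinearOrder β] {s : Fin m → β}
    (hs : StrictMono s) (k : Fin m) :
    (Finset.univ.filter fun i : Fin m => s i ≤ s k).card = k + 1 := by
  simp only [hs.le_iff_le]
  rw [Finset.filter_ge_eq_Iic, Fin.card_Iic]

/-- First assertion of Theorem 2: bound on the conservativeness remainder `R` for the
DKW-band-based simultaneous prediction set.  With `ε = sqrt(ln(2/δ)/(2m))`, distinct
scores `s 0 < ⋯ < s (m-1)`, empirical CDF `F̂`, bands `ℓ = F̂ - ε`, `u = F̂ + ε`, and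
`j_α` the smallest `j ∈ {1,…,m}` with `j/m ≥ 1 - α + ε`, taking `Q = s_{j_α}` one has
`R := (ℓ(Q) - (1-α)) + (u(Q) - ℓ(Q)) ≤ sqrt(2 ln(2/δ)/m) + 1/m`. -/
theorem dkw_remainder_bound
    (m : ℕ) (hm : 1 ≤ m) (δ α : ℝ)
    (hδ : δ ∈ Set.Ioo (0 : ℝ) 1) (hα : α ∈ Set.Ioo (0 : ℝ) 1)
    (ε : ℝ) (hε : ε = Real.sqrt (Real.log (2 / δ) / (2 * m)))
    (s : Fin m → ℝ) (hs : StrictMono s)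
    (Fhat : ℝ → ℝ)
    (hFhat : ∀ t : ℝ,
      Fhat t = ((Finset.univ.filter fun i : Fin m => s i ≤ t).card : ℝ) / m)
    (ℓ u : ℝ → ℝ)
    (hℓ : ∀ t, ℓ t = Fhat t - ε) (hu : ∀ t, u t = Fhat t + ε)
    (jα : ℕ) (hjα : jα ∈ Finset.Icc 1 m)
    (hjαge : (jα : ℝ) / m ≥ 1 - α + ε)
    (hjαmin : ∀ j ∈ Finset.Icc 1 m, (j : ℝ) / m ≥ 1 - α + ε → jα ≤ j)
    (Q : ℝ) (hQ : Q = s ⟨jα - 1, by have := Finset.mem_Icc.mp hjα; omega⟩)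
    (R : ℝ) (hR : R = (ℓ Q - (1 - α)) + (u Q - ℓ Q)) :
    R ≤ Real.sqrt (2 * Real.log (2 / δ) / m) + 1 / m := by
  obtain ⟨hj1, hjm⟩ := Finset.mem_Icc.mp hjα
  have hm0 : (0 : ℝ) < m := by exact_mod_cast hm
  have hF : Fhat Q = (jα : ℝ) / m := by
    rw [hFhat, hQ, hs.card_filter_le_apply]
    simp only [Nat.sub_add_cancel hj1]
  have hprev : ((jα : ℝ) - 1) / m ≤ 1 - α + ε := by
    rcases hj1.eq_or_lt with h | h
    · have hε0 : 0 ≤ ε := hε ▸ Real.sqrt_nonneg _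
      simp only [← h, Nat.cast_one, sub_self, zero_div]
      linarith [hα.2]
    · by_contra! hlt
      have := hjαmin (jα - 1) (Finset.mem_Icc.mpr ⟨by omega, by omega⟩)
        (by rw [Nat.cast_sub hj1, Nat.cast_one]; exact hlt.le)
      omega
  have hsqrt : Real.sqrt (2 * Real.log (2 / δ) / m) = 2 * ε := by
    rw [hε, show 2 * Real.log (2 / δ) / m = 2 ^ 2 * (Real.log (2 / δ) / (2 * m)) by
      field_simp, Real.sqrt_mul (by norm_num), Real.sqrt_sq (by norm_num)]
  rw [hR, hsqrt, hu, hF]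
  rw [sub_div] at hprev
  linarith
end

section
/- Let m ≥ 1 be an integer and α, δ ∈ (0,1). Set ε = sqrt(ln(2/δ)/(2m)) and suppose there exists j ∈ {1,…,m} with j/m ≥ 1 − α + ε; let j_α be the smallest such j. Let μ be a Borel probability measure on ℝ whose CDF F(t) = μ((−∞,t]) is continuous, and consider the i.i.d. sample given by the coordinate maps S_1,…,S_m on the product space (ℝ^m, μ^{⊗m}), with order statistics S_{(1)} ≤ ⋯ ≤ S_{(m)}. Then μ^{⊗m}({s ∈ ℝ^m : F(s_{(j_α)}) ≥ 1 − α}) ≥ 1 − κ^DKW_{α,δ} ≥ 1 − δ/2. -/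
open MeasureTheory

/-- `Δ_m^DKW = sqrt(2 ln(2/δ)/(9m)) + 1/(3m)`. -/
noncomputable def deltaDKW (m : ℕ) (δ : ℝ) : ℝ :=
  Real.sqrt (2 * Real.log (2 / δ) / (9 * m)) + 1 / (3 * m)

/-- The piecewise constant `κ^DKW_{α,δ}` from Theorem 2. -/
noncomputable def kappaDKW (m : ℕ) (α δ : ℝ) : ℝ :=
  if α ≤ 1 / 2 then (δ / 2) ^ ((4 * α * (1 - α))⁻¹)
  else if α ≤ 1 / 2 + deltaDKW m δ then δ / 2
  else (δ / 2) ^ ((4 * (α - deltaDKW m δ) * (1 - α + deltaDKW m δ))⁻¹)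

/-- The `j`-th order statistic (`j : Fin m`, zero-based) of `s : Fin m → ℝ`. -/
noncomputable def orderStat {m : ℕ} (s : Fin m → ℝ) (j : Fin m) : ℝ :=
  (s ∘ Tuple.sort s) j

/-- Tangent line bound for the convex function `x ↦ 1 / x` on the positive reals. -/
lemma inv_ge_tangent {x c : ℝ} (hx : 0 < x) (hc : 0 < c) :
    1 / c - (x - c) / c ^ 2 ≤ 1 / x := by
  have h : 1 / x - (1 / c - (x - c) / c ^ 2) = (x - c) ^ 2 / (x * c ^ 2) := by
    field_simp
    ring
  have : 0 ≤ (x - c) ^ 2 / (x * c ^ 2) := by positivity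
  linarith

/-- Lower bound for the relative entropy between Bernoulli distributions. -/
lemma bernoulli_kl_lower_bound {p q : ℝ} (hp : 0 < p) (hpq : p < q) (hq : q < 1) :
    (q - p) ^ 2 / (2 * ((p + (q - p) / 3) * (1 - (p + (q - p) / 3)))) ≤
      q * Real.log q - q * Real.log p + (1 - q) * Real.log (1 - q)
        - (1 - q) * Real.log (1 - p) := by
  set c := p + (q - p) / 3 with hc
  have hc0 : 0 < c := by linarith
  have hc1 : 0 < 1 - c := by linarith
  set A := 1 / c + 1 / (1 - c) with hA
  set B := 1 / (1 - c) ^ 2 - 1 / c ^ 2 with hB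
  let G : ℝ → ℝ := fun x => -(q * Real.log x) - (1 - q) * Real.log (1 - x)
    - (A * (q - x) ^ 2 / 2 + B * ((q - c) * (q - x) ^ 2 / 2 - (q - x) ^ 3 / 3))
  have hderiv : ∀ x ∈ Set.Icc p q, HasDerivAt G
      (-(q * (1 / x)) - (1 - q) * ((-1) / (1 - x))
        + (q - x) * (A + B * (x - c))) x := by
    intro x hx
    have hx0 : x ≠ 0 := by linarith [hx.1]
    have hx1 : 1 - x ≠ 0 := by linarith [hx.2]
    have hs : HasDerivAt (fun y : ℝ => 1 - y) (-1) x := by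
      simpa using (hasDerivAt_id x).const_sub 1
    have hu : HasDerivAt (fun y : ℝ => q - y) (-1) x := by
      simpa using (hasDerivAt_id x).const_sub q
    have h1 := ((Real.hasDerivAt_log hx0).const_mul q).neg
    have h2 := (hs.log hx1).const_mul (1 - q)
    have h3 := ((hu.pow 2).const_mul A).div_const 2
    have h4 := ((((hu.pow 2).const_mul (q - c)).div_const 2).sub
      ((hu.pow 3).div_const 3)).const_mul B
    refine ((h1.sub h2).sub (h3.add h4)).congr_deriv ?_
    push_cast
    ring
  have hanti : AntitoneOn G (Set.Icc p q) := by
    refine antitoneOn_of_deriv_nonpos (convex_Icc p q)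
      (fun x hx => (hderiv x hx).continuousAt.continuousWithinAt)
      (fun x hx => (hderiv x (interior_subset hx)).differentiableAt.differentiableWithinAt) ?_
    intro x hx
    have hx' := interior_subset hx
    rw [(hderiv x hx').deriv]
    have hx0 : 0 < x := by linarith [hx'.1]
    have hx1 : 0 < 1 - x := by linarith [hx'.2]
    have e1 := inv_ge_tangent hx0 hc0
    have e2 := inv_ge_tangent hx1 hc1
    have e3 : -(q * (1 / x)) - (1 - q) * ((-1) / (1 - x))
        = -((q - x) * (1 / x + 1 / (1 - x))) := by
      field_simp
      ring
    have e4 : A + B * (x - c) = (1 / c - (x - c) / c ^ 2)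
        + (1 / (1 - c) - ((1 - x) - (1 - c)) / (1 - c) ^ 2) := by
      rw [hA, hB]
      ring
    have e5 : 0 ≤ q - x := by linarith [hx'.2]
    rw [e3, e4]
    nlinarith [mul_nonneg e5 (add_nonneg (sub_nonneg.2 e1) (sub_nonneg.2 e2))]
  have hG := hanti (Set.left_mem_Icc.2 hpq.le) (Set.right_mem_Icc.2 hpq.le) hpq.le
  have hval : (q - p) ^ 2 / (2 * (c * (1 - c))) = A * (q - p) ^ 2 / 2 := by
    rw [hA]
    field_simp
    ring
  have hzero : (q - c) * (q - p) ^ 2 / 2 - (q - p) ^ 3 / 3 = 0 := by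
    rw [hc]
    ring
  simp only [G, hzero, sub_self] at hG
  rw [hval]
  norm_num at hG
  linarith

open scoped Classical in
/-- Exponential Markov bound for the number of sample points falling in `A`. -/
lemma pi_real_card_mem_ge_le {Ω : Type*} [MeasurableSpace Ω] (μ : Measure Ω)
    [IsProbabilityMeasure μ] {A : Set Ω} (hA : MeasurableSet A) (m k : ℕ) {r : ℝ} (hr : 1 ≤ r) :
    r ^ k * (Measure.pi fun _ : Fin m => μ).real
        {s | k ≤ (Finset.univ.filter fun i => s i ∈ A).card} ≤
      (1 - μ.real A + μ.real A * r) ^ m := by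
  let f : Ω → ℝ := fun x => 1 + A.indicator (fun _ => r - 1) x
  have hf : Integrable f μ :=
    (integrable_const _).add ((integrable_const _).indicator hA)
  have hfval : ∀ x, f x = if x ∈ A then r else 1 := by
    intro x
    by_cases hx : x ∈ A <;> simp [f, hx]
  have hint : ∫ x, f x ∂μ = 1 - μ.real A + μ.real A * r := by
    rw [integral_add (integrable_const _) ((integrable_const _).indicator hA),
      integral_indicator_const _ hA]
    simp
    ring
  have hprod : ∀ s : Fin m → Ω,
      ∏ i, f (s i) = r ^ (Finset.univ.filter fun i => s i ∈ A).card := by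
    intro s
    simp [hfval, Finset.prod_ite]
  have hmarkov := mul_meas_ge_le_integral_of_nonneg
    (μ := Measure.pi fun _ : Fin m => μ) (f := fun s => ∏ i, f (s i))
    (Filter.Eventually.of_forall fun s => by
      simp only [hprod, Pi.zero_apply]
      positivity)
    (Integrable.fintype_prod fun _ => hf) (r ^ k)
  rw [integral_fintype_prod_eq_prod (fun _ : Fin m => f)] at hmarkov
  simp only [hint, Finset.prod_const, Finset.card_univ, Fintype.card_fin] at hmarkov
  refine le_trans (mul_le_mul_of_nonneg_left (measureReal_mono ?_) (by positivity)) hmarkov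
  intro s hs
  simp only [Set.mem_ofPred_eq, hprod] at hs ⊢
  exact pow_le_pow_right₀ hr hs

open scoped Classical in
/-- Variance-sensitive Chernoff bound, away from the endpoint `q = 1`. -/
lemma pi_real_card_mem_ge_le_exp_of_lt_one {Ω : Type*} [MeasurableSpace Ω] (μ : Measure Ω)
    [IsProbabilityMeasure μ] {A : Set Ω} (hA : MeasurableSet A) (m k : ℕ) {p q : ℝ}
    (hp : 0 < p) (hpq : p < q) (hq : q < 1) (hAp : μ.real A ≤ p) (hk : m * q ≤ k) :
    (Measure.pi fun _ : Fin m => μ).real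
        {s | k ≤ (Finset.univ.filter fun i => s i ∈ A).card} ≤
      Real.exp (-(m * ((q - p) ^ 2 / (2 * ((p + (q - p) / 3) * (1 - (p + (q - p) / 3))))))) := by
  have hq0 : 0 < q := hp.trans hpq
  have hp1 : 0 < 1 - p := by linarith
  have hq1 : 0 < 1 - q := by linarith
  set r := q * (1 - p) / (p * (1 - q)) with hr
  have hr0 : 0 < r := by positivity
  have hr1 : 1 ≤ r := by
    rw [hr, one_le_div (by positivity)]
    nlinarith
  have hlogr : Real.log r
      = Real.log q + Real.log (1 - p) - (Real.log p + Real.log (1 - q)) := by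
    rw [hr, Real.log_div (by positivity) (by positivity), Real.log_mul hq0.ne' hp1.ne',
      Real.log_mul hp.ne' hq1.ne']
  have hbase : 1 - μ.real A + μ.real A * r ≤ (1 - p) / (1 - q) := by
    have : (1 - p) / (1 - q) = 1 - p + p * r := by
      rw [hr]
      field_simp
      ring
    rw [this]
    nlinarith
  have hbase0 : 0 ≤ 1 - μ.real A + μ.real A * r := by
    nlinarith [measureReal_nonneg (μ := μ) (s := A)]
  have hmain := (pi_real_card_mem_ge_le μ hA m k hr1).trans (pow_le_pow_left₀ hbase0 hbase m)
  have hrk : r ^ k = Real.exp (k * Real.log r) := by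
    rw [Real.exp_nat_mul, Real.exp_log hr0]
  have hbm : ((1 - p) / (1 - q)) ^ m
      = Real.exp (m * (Real.log (1 - p) - Real.log (1 - q))) := by
    rw [Real.exp_nat_mul, ← Real.log_div hp1.ne' hq1.ne', Real.exp_log (by positivity)]
  rw [hrk, hbm, ← le_div_iff₀' (Real.exp_pos _), ← Real.exp_sub] at hmain
  refine hmain.trans (Real.exp_le_exp.2 ?_)
  have hkl := mul_le_mul_of_nonneg_left (bernoulli_kl_lower_bound hp hpq hq)
    (Nat.cast_nonneg (α := ℝ) m)
  have hkr := mul_le_mul_of_nonneg_right hk (Real.log_nonneg hr1)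
  have hid : m * (Real.log (1 - p) - Real.log (1 - q)) - m * q * Real.log r
      = -(m * (q * Real.log q - q * Real.log p + (1 - q) * Real.log (1 - q)
        - (1 - q) * Real.log (1 - p))) := by
    rw [hlogr]
    ring
  linarith

open scoped Classical in
/-- Variance-sensitive Chernoff bound for the number of sample points falling in `A`. -/
lemma pi_real_card_mem_ge_le_exp {Ω : Type*} [MeasurableSpace Ω] (μ : Measure Ω)
    [IsProbabilityMeasure μ] {A : Set Ω} (hA : MeasurableSet A) (m k : ℕ) {p q : ℝ}
    (hp : 0 < p) (hpq : p < q) (hq : q ≤ 1) (hAp : μ.real A ≤ p) (hk : m * q ≤ k) :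
    (Measure.pi fun _ : Fin m => μ).real
        {s | k ≤ (Finset.univ.filter fun i => s i ∈ A).card} ≤
      Real.exp (-(m * ((q - p) ^ 2 / (2 * ((p + (q - p) / 3) * (1 - (p + (q - p) / 3))))))) := by
  have hc0 : 0 < p + (q - p) / 3 := by linarith
  have hc1 : 0 < 1 - (p + (q - p) / 3) := by linarith
  have hcont : ContinuousAt (fun x : ℝ => Real.exp (-(m * ((x - p) ^ 2
      / (2 * ((p + (x - p) / 3) * (1 - (p + (x - p) / 3)))))))) q := by
    have : 2 * ((p + (q - p) / 3) * (1 - (p + (q - p) / 3))) ≠ 0 := by positivity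
    fun_prop (disch := assumption)
  refine ge_of_tendsto (hcont.tendsto.mono_left (nhdsWithin_le_nhds (s := Set.Iio q))) ?_
  filter_upwards [Ioo_mem_nhdsLT hpq] with x hx
  exact pi_real_card_mem_ge_le_exp_of_lt_one μ hA m k hp hx.1 (hx.2.trans_le hq) hAp
    ((mul_le_mul_of_nonneg_left hx.2.le (Nat.cast_nonneg m)).trans hk)

/-- A sublevel set of a continuous distribution function has at most the expected mass. -/
lemma measureReal_cdf_lt_le (μ : Measure ℝ) [IsProbabilityMeasure μ] {F : ℝ → ℝ}
    (hF : ∀ t, F t = μ.real (Set.Iic t)) (hFcont : Continuous F) {p : ℝ}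
    (hp : 0 ≤ p) (hp1 : p < 1) : μ.real {t | F t < p} ≤ p := by
  rcases Set.eq_empty_or_nonempty {t | F t < p} with h | h
  · simpa [h] using hp
  have hmono : Monotone F := fun a b hab => by
    rw [hF, hF]
    exact measureReal_mono (Set.Iic_subset_Iic.2 hab)
  have hlim : Filter.Tendsto F Filter.atTop (nhds 1) := by
    have : F = ProbabilityTheory.cdf μ := by
      funext t
      rw [hF, ProbabilityTheory.cdf_eq_real]
    rw [this]
    exact ProbabilityTheory.tendsto_cdf_atTop μ
  obtain ⟨b, hb⟩ := (hlim.eventually_const_lt hp1).exists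
  have hbdd : BddAbove {t | F t < p} :=
    ⟨b, fun t ht => le_of_not_gt fun hbt => absurd (hmono hbt.le) (not_le.2 (ht.out.trans hb))⟩
  have hsup : F (sSup {t | F t < p}) ≤ p :=
    closure_minimal (fun t ht => ht.out.le) (isClosed_le hFcont continuous_const)
      (csSup_mem_closure h hbdd)
  refine le_trans (measureReal_mono fun t ht => ?_) ((hF _).symm.trans_le hsup)
  exact le_csSup hbdd ht

open scoped Classical in
/-- If the order statistic at (zero-based) position `j` lies in a lower set, then so do at least
`j + 1` of the sample points. -/
lemma succ_le_card_of_orderStat_mem {m : ℕ} (s : Fin m → ℝ) (j : Fin m) {A : Set ℝ}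
    (hA : IsLowerSet A) (hj : orderStat s j ∈ A) :
    (j : ℕ) + 1 ≤ (Finset.univ.filter fun i => s i ∈ A).card := by
  rw [← Fin.card_Iic, ← Finset.card_map (Tuple.sort s).toEmbedding]
  refine Finset.card_le_card fun i hi => ?_
  obtain ⟨l, hl, rfl⟩ := Finset.mem_map.1 hi
  simp only [Finset.mem_filter, Finset.mem_univ, true_and]
  exact hA (Tuple.monotone_sort s (Finset.mem_Iic.1 hl)) hj

lemma half_rpow_inv_le_half {δ v : ℝ} (hδ : δ ∈ Set.Ioo (0 : ℝ) 1) (hv : 0 < v)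
    (hv1 : v ≤ 1) : (δ / 2) ^ v⁻¹ ≤ δ / 2 := by
  have h := Real.rpow_le_rpow_of_exponent_ge (x := δ / 2) (by linarith [hδ.1])
    (by linarith [hδ.2]) ((one_le_inv₀ hv).2 hv1)
  simpa using h

/-- `kappaDKW` has the form `(δ / 2) ^ v⁻¹` where `v / 4` dominates the Bernoulli variance at the
point `1 - α + ε / 3`. -/
lemma exists_kappaDKW_eq (m : ℕ) {α δ ε : ℝ} (hα : α ∈ Set.Ioo (0 : ℝ) 1)
    (hε0 : 0 ≤ ε) (hεΔ : ε / 3 ≤ deltaDKW m δ) :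
    ∃ v, 0 < v ∧ v ≤ 1 ∧ kappaDKW m α δ = (δ / 2) ^ v⁻¹ ∧
      4 * ((1 - α + ε / 3) * (1 - (1 - α + ε / 3))) ≤ v := by
  obtain ⟨h0, h1⟩ := hα
  unfold kappaDKW
  split_ifs with ha hb
  · refine ⟨_, ?_, ?_, rfl, ?_⟩
    · have := mul_pos h0 (sub_pos.2 h1)
      linarith
    · nlinarith [sq_nonneg (2 * α - 1)]
    · nlinarith [mul_nonneg hε0 (sub_nonneg.2 ha)]
  · refine ⟨1, one_pos, le_rfl, by simp, ?_⟩
    nlinarith [sq_nonneg (2 * (1 - α + ε / 3) - 1)]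
  · set D := deltaDKW m δ
    have hD : 0 ≤ D := by linarith
    refine ⟨_, ?_, ?_, rfl, ?_⟩
    · have := mul_pos (show 0 < α - D by linarith) (show 0 < 1 - α + D by linarith)
      linarith
    · nlinarith [sq_nonneg (2 * (α - D) - 1)]
    · nlinarith [mul_nonneg (sub_nonneg.2 hεΔ) (show 0 ≤ 2 * α - 1 - D - ε / 3 by linarith)]

/-- Second assertion of Theorem 2: the marginal PAC coverage guarantee of the DKW
simultaneous prediction set.  With `ε = sqrt(ln(2/δ)/(2m))` and `j_α` the smallest
`j ∈ {1,…,m}` with `j/m ≥ 1 - α + ε`, for an i.i.d. sample of size `m` from a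
distribution `μ` with continuous CDF `F`, one has
`μ^{⊗m}(F(S_{(j_α)}) ≥ 1 - α) ≥ 1 - κ^DKW_{α,δ} ≥ 1 - δ/2`. -/
theorem dkw_marginal_coverage
    (m : ℕ) (hm : 1 ≤ m) (α δ : ℝ)
    (hα : α ∈ Set.Ioo (0 : ℝ) 1) (hδ : δ ∈ Set.Ioo (0 : ℝ) 1)
    (ε : ℝ) (hε : ε = Real.sqrt (Real.log (2 / δ) / (2 * m)))
    (jα : ℕ) (hjα : jα ∈ Finset.Icc 1 m)
    (hjαge : (jα : ℝ) / m ≥ 1 - α + ε)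
    (hjαmin : ∀ j ∈ Finset.Icc 1 m, (j : ℝ) / m ≥ 1 - α + ε → jα ≤ j)
    (μ : Measure ℝ) [IsProbabilityMeasure μ]
    (F : ℝ → ℝ) (hF : ∀ t, F t = (μ (Set.Iic t)).toReal) (hFcont : Continuous F) :
    (Measure.pi fun _ : Fin m => μ)
        {s : Fin m → ℝ |
          F (orderStat s ⟨jα - 1, by have := Finset.mem_Icc.mp hjα; omega⟩) ≥ 1 - α}
      ≥ ENNReal.ofReal (1 - kappaDKW m α δ) ∧
    1 - kappaDKW m α δ ≥ 1 - δ / 2 := by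
  classical
  obtain ⟨hj1, hjm⟩ := Finset.mem_Icc.mp hjα
  have hm0 : (0 : ℝ) < m := by exact_mod_cast hm
  have hlog : 0 < Real.log (2 / δ) :=
    Real.log_pos ((one_lt_div hδ.1).2 (by linarith [hδ.2]))
  have hε0 : 0 < ε := by
    rw [hε]
    positivity
  have hεsq : 2 * m * ε ^ 2 = Real.log (2 / δ) := by
    rw [hε, Real.sq_sqrt (by positivity)]
    field_simp
  have hq1 : 1 - α + ε ≤ 1 :=
    hjαge.le.trans ((div_le_one hm0).2 (by exact_mod_cast hjm))
  have hεΔ : ε / 3 ≤ deltaDKW m δ := by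
    have hle : ε / 3 ≤ Real.sqrt (2 * Real.log (2 / δ) / (9 * m)) := by
      refine Real.le_sqrt_of_sq_le ?_
      rw [← hεsq, le_div_iff₀ (by positivity)]
      nlinarith [mul_pos hm0 (pow_pos hε0 2)]
    have : (0 : ℝ) ≤ 1 / (3 * m) := by positivity
    unfold deltaDKW
    linarith
  obtain ⟨v, hv0, hv1, hκ, hv⟩ :=
    exists_kappaDKW_eq m hα hε0.le hεΔ
  refine ⟨?_, ?_⟩
  swap
  · rw [hκ]
    linarith [half_rpow_inv_le_half hδ hv0 hv1]
  have hmono : Monotone F := fun a b hab => by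
    rw [hF, hF]
    exact measureReal_mono (Set.Iic_subset_Iic.2 hab)
  have hk : m * (1 - α + ε) ≤ jα := by
    have := (le_div_iff₀ hm0).1 hjαge
    linarith
  have hbad := pi_real_card_mem_ge_le_exp μ
    (measurableSet_lt hFcont.measurable measurable_const) m jα
    (sub_pos.2 hα.2) (lt_add_of_pos_right _ hε0) hq1
    (measureReal_cdf_lt_le μ hF hFcont (sub_pos.2 hα.2).le (by linarith [hα.1])) hk
  have hbound : (Measure.pi fun _ : Fin m => μ).real
      {s | jα ≤ (Finset.univ.filter fun i => s i ∈ {t | F t < 1 - α}).card}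
        ≤ kappaDKW m α δ := by
    refine hbad.trans ?_
    rw [add_sub_cancel_left, hκ, Real.rpow_def_of_pos (by linarith [hδ.1]),
      ← inv_div 2 δ, Real.log_inv, ← hεsq]
    refine Real.exp_le_exp.2 ?_
    have hc : 0 < (1 - α + ε / 3) * (1 - (1 - α + ε / 3)) :=
      mul_pos (by linarith [hα.2]) (by linarith)
    have : ε ^ 2 * (2 * v⁻¹) ≤ ε ^ 2 / (2 * ((1 - α + ε / 3) * (1 - (1 - α + ε / 3)))) := by
      rw [div_eq_mul_inv]
      refine mul_le_mul_of_nonneg_left ?_ (sq_nonneg ε)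
      rw [← div_eq_mul_inv, div_le_iff₀ hv0, inv_mul_eq_div, le_div_iff₀ (by positivity)]
      linarith
    have := mul_le_mul_of_nonneg_left this hm0.le
    linarith
  have hcover : (Set.univ : Set (Fin m → ℝ)) ⊆
      {s | F (orderStat s ⟨jα - 1, by omega⟩) ≥ 1 - α} ∪
      {s | jα ≤ (Finset.univ.filter fun i => s i ∈ {t | F t < 1 - α}).card} := by
    intro s _
    by_cases hs : F (orderStat s ⟨jα - 1, by omega⟩) ≥ 1 - α
    · exact Or.inl hs
    · have := succ_le_card_of_orderStat_mem s ⟨jα - 1, by omega⟩ (A := {t | F t < 1 - α})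
        (fun a b hba ha => (hmono hba).trans_lt ha) (not_le.1 hs)
      exact Or.inr (by simpa [Nat.sub_add_cancel hj1] using this)
  have hone := (measureReal_mono (μ := Measure.pi fun _ : Fin m => μ) hcover).trans
    (measureReal_union_le _ _)
  rw [probReal_univ] at hone
  exact ENNReal.ofReal_le_of_le_toReal (by rw [← measureReal_def]; linarith)
end

section
/- Let m ≥ 1 be an integer, α ∈ (0,1), and let (ℓ_j)_{j=0}^m and (u_j)_{j=0}^m be real numbers satisfying ℓ_j ≤ j/m ≤ u_j for every j ∈ {0,1,…,m}. Suppose there exists j ∈ {1,…,m} with ℓ_j ≥ 1 − α, and let j_α be the smallest such j. Then, with w_j = u_j − ℓ_j, the quantity R := (ℓ_{j_α} − (1−α)) + (u_{j_α} − ℓ_{j_α}) satisfies R ≤ w_{j_α} + w_{j_α − 1} + 1/m. -/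
/-- First assertion of Theorem 3: the bound on the conservativeness remainder for the
Dümbgen–Wellner simultaneous prediction set.  Given band values `ℓ_j ≤ j/m ≤ u_j`
(`j = 0,…,m`) and `j_α` the smallest `j ∈ {1,…,m}` with `ℓ_j ≥ 1 - α`, the quantity
`R := (ℓ_{j_α} - (1-α)) + (u_{j_α} - ℓ_{j_α})` satisfies
`R ≤ w_{j_α} + w_{j_α - 1} + 1/m`, where `w_j = u_j - ℓ_j`. -/
theorem dw_remainder_bound
    (m : ℕ) (hm : 1 ≤ m) (α : ℝ) (hα : α ∈ Set.Ioo (0 : ℝ) 1)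
    (ℓ u : ℕ → ℝ)
    (hband : ∀ j ≤ m, ℓ j ≤ (j : ℝ) / m ∧ (j : ℝ) / m ≤ u j)
    (jα : ℕ) (hjα : jα ∈ Finset.Icc 1 m)
    (hjαge : ℓ jα ≥ 1 - α)
    (hjαmin : ∀ j ∈ Finset.Icc 1 m, ℓ j ≥ 1 - α → jα ≤ j)
    (w : ℕ → ℝ) (hw : ∀ j, w j = u j - ℓ j)
    (R : ℝ) (hR : R = (ℓ jα - (1 - α)) + (u jα - ℓ jα)) :
    R ≤ w jα + w (jα - 1) + 1 / m := by
  obtain ⟨hj1, hjm⟩ := Finset.mem_Icc.mp hjα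
  obtain ⟨k, rfl⟩ := Nat.exists_eq_add_of_le' hj1
  rw [Nat.add_sub_cancel, hw, hw, hR]
  have hprev : ℓ k < 1 - α := by
    rcases Nat.eq_zero_or_pos k with rfl | hk
    · have h0 := (hband 0 (Nat.zero_le m)).1
      rw [Nat.cast_zero, zero_div] at h0
      linarith [hα.2]
    · by_contra! h
      have := hjαmin k (Finset.mem_Icc.mpr ⟨hk, by omega⟩) h
      omega
  have hstep : ℓ (k + 1) ≤ u k + 1 / m := by
    have hℓ := (hband (k + 1) hjm).1
    have hu := (hband k (by omega)).2
    rw [Nat.cast_add_one, add_div] at hℓ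
    linarith
  linarith
end

section
/- Let n ≥ 1 and m ≥ 1 be integers and ν ≥ 0. Let G = Σ_{i=1}^m p_i · δ_{u_i} be a discrete probability measure on ℝ with atoms u_1 < ⋯ < u_m and weights p_i > 0 summing to 1, and let G(t) = Σ_{i : u_i ≤ t} p_i denote its CDF. For a sample y = (y_1,…,y_n) ∈ ℝ^n define Ĝ_n^y(t) = (1/n)·#{j : y_j ≤ t} and the discrete DW statistic T_G(y) = sup over i ∈ {1,…,m} with G(u_i) ∈ (0,1) of [n·K(Ĝ_n^y(u_i), G(u_i)) − C_ν(Ĝ_n^y(u_i), G(u_i))]. Then there exists a Borel probability measure μ on ℝ with continuous CDF F such that, defining for x = (x_1,…,x_n) ∈ ℝ^n the statistic T_F(x) = sup over t ∈ ℝ with F(t) ∈ (0,1) of [n·K(F̂_n^x(t), F(t)) − C_ν(F̂_n^x(t), F(t))] with F̂_n^x(t) = (1/n)·#{j : x_j ≤ t}, one has for every r ∈ ℝ: G^{⊗n}({y : T_G(y) > r}) ≤ μ^{⊗n}({x : T_F(x) > r}). -/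
open MeasureTheory

/-- Bernoulli Kullback–Leibler divergence
`K(a,b) = a log(a/b) + (1-a) log((1-a)/(1-b))` (with `0·log 0 = 0`, via `log 0 = 0`). -/
noncomputable def KL (a b : ℝ) : ℝ :=
  a * Real.log (a / b) + (1 - a) * Real.log ((1 - a) / (1 - b))

/-- `C(t) = log(log(e/(4t(1-t))))`. -/
noncomputable def Cfun (t : ℝ) : ℝ :=
  Real.log (Real.log (Real.exp 1 / (4 * t * (1 - t))))

/-- `D(t) = log(1 + C(t)^2)`. -/
noncomputable def Dfun (t : ℝ) : ℝ :=
  Real.log (1 + (Cfun t) ^ 2)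

/-- `C_ν^u(t) = C(t) + ν·D(t)`. -/
noncomputable def Cnu (ν t : ℝ) : ℝ :=
  Cfun t + ν * Dfun t

/-- `C_ν(u,v) = inf{C_ν^u(t) : t ∈ [min(u,v), max(u,v)] ∩ (0,1)}`. -/
noncomputable def CnuPair (ν u v : ℝ) : ℝ :=
  sInf (Cnu ν '' (Set.Icc (min u v) (max u v) ∩ Set.Ioo 0 1))

/-- The empirical CDF of the sample `x : Fin n → ℝ`. -/
noncomputable def empCDF (n : ℕ) (x : Fin n → ℝ) (t : ℝ) : ℝ :=
  ((Finset.univ.filter fun j : Fin n => x j ≤ t).card : ℝ) / n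

/-- The discrete Dümbgen–Wellner statistic: supremum (in `EReal`) over the atoms
`u_i` with `Gcdf(u_i) ∈ (0,1)` of the adjusted KL divergence between the empirical
CDF of `y` and `Gcdf`. -/
noncomputable def Tdisc (n m : ℕ) (ν : ℝ) (u : Fin m → ℝ) (Gcdf : ℝ → ℝ)
    (y : Fin n → ℝ) : EReal :=
  sSup ((fun i : Fin m =>
      (((n : ℝ) * KL (empCDF n y (u i)) (Gcdf (u i))
        - CnuPair ν (empCDF n y (u i)) (Gcdf (u i)) : ℝ) : EReal)) ''
      {i | Gcdf (u i) ∈ Set.Ioo 0 1})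

/-- The continuous Dümbgen–Wellner statistic: supremum (in `EReal`) over all
`t ∈ ℝ` with `F(t) ∈ (0,1)` of the adjusted KL divergence between the empirical
CDF of `x` and `F`. -/
noncomputable def Tcont (n : ℕ) (ν : ℝ) (F : ℝ → ℝ) (x : Fin n → ℝ) : EReal :=
  sSup ((fun t : ℝ =>
      (((n : ℝ) * KL (empCDF n x t) (F t)
        - CnuPair ν (empCDF n x t) (F t) : ℝ) : EReal)) ''
      {t | F t ∈ Set.Ioo 0 1})

/-- The distribution function of a probability measure without atoms is continuous. -/
lemma continuous_measure_Iic_toReal (μ : Measure ℝ) [IsProbabilityMeasure μ]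
    [NullSingletonClass μ] : Continuous fun t => (μ (Set.Iic t)).toReal := by
  have hfun : (fun t => (μ (Set.Iic t)).toReal) = ProbabilityTheory.cdf μ := by
    funext t
    rw [ProbabilityTheory.cdf_eq_real, measureReal_def]
  rw [hfun, continuous_iff_continuousAt]
  intro a
  have hmono : Monotone (ProbabilityTheory.cdf μ) := ProbabilityTheory.monotone_cdf μ
  have hzero : (ProbabilityTheory.cdf μ).measure {a} = 0 := by
    rw [ProbabilityTheory.measure_cdf, measure_singleton]
  rw [StieltjesFunction.measure_singleton, ENNReal.ofReal_eq_zero] at hzero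
  rw [hmono.continuousAt_iff_leftLim_eq_rightLim, StieltjesFunction.rightLim_eq]
  exact le_antisymm (hmono.leftLim_le le_rfl) (by linarith)

lemma exists_gap_of_strictMono {m : ℕ} {u : Fin m → ℝ} (hu : StrictMono u) (k : Fin m) :
    ∃ ε : ℝ, 0 < ε ∧ ∀ j < k, u j < u k - ε := by
  have hev : ∀ᶠ ε : ℝ in nhdsWithin 0 (Set.Ioi 0), ∀ j, j < k → u j < u k - ε := by
    refine Filter.eventually_all.2 fun j => ?_
    by_cases hj : j < k
    · have hpos : 0 < u k - u j := sub_pos.2 (hu hj)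
      filter_upwards [Ioo_mem_nhdsGT hpos] with ε hε _
      linarith [hε.2]
    · exact Filter.Eventually.of_forall fun _ h => absurd h hj
  obtain ⟨ε, hε, hpos⟩ := (hev.and self_mem_nhdsWithin).exists
  exact ⟨ε, hpos, hε⟩

lemma measurableSet_lt_Tdisc (n m : ℕ) (ν : ℝ) (u : Fin m → ℝ) (F : ℝ → ℝ) (r : EReal) :
    MeasurableSet {y | r < Tdisc n m ν u F y} := by
  have hcount : ∀ t : ℝ, Measurable fun y : Fin n → ℝ =>
      (Finset.univ.filter fun j : Fin n => y j ≤ t).card := by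
    intro t
    simp only [Finset.card_filter]
    refine Finset.measurable_sum _ fun j _ => ?_
    exact Measurable.ite (measurableSet_le (measurable_pi_apply j) measurable_const)
      measurable_const measurable_const
  simp only [Tdisc, lt_sSup_iff, Set.exists_mem_image]
  have hset : {y : Fin n → ℝ | ∃ i ∈ {i | F (u i) ∈ Set.Ioo 0 1},
      r < (((n : ℝ) * KL (empCDF n y (u i)) (F (u i))
        - CnuPair ν (empCDF n y (u i)) (F (u i)) : ℝ) : EReal)} =
      ⋃ i ∈ {i | F (u i) ∈ Set.Ioo 0 1},
        (fun y : Fin n → ℝ => (Finset.univ.filter fun j : Fin n => y j ≤ u i).card) ⁻¹'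
          {c : ℕ | r < (((n : ℝ) * KL ((c : ℝ) / n) (F (u i))
            - CnuPair ν ((c : ℝ) / n) (F (u i)) : ℝ) : EReal)} := by
    ext y
    simp [empCDF]
  rw [hset]
  exact MeasurableSet.biUnion (Set.to_countable _) fun i _ => hcount (u i) (.of_discrete)

lemma Tdisc_le_Tcont {n m : ℕ} {ν : ℝ} {u : Fin m → ℝ} {G F : ℝ → ℝ} {y x : Fin n → ℝ}
    (hGF : ∀ i, F (u i) = G (u i)) (hyx : ∀ i j, x j ≤ u i ↔ y j ≤ u i) :
    Tdisc n m ν u G y ≤ Tcont n ν F x := by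
  have hemp : ∀ i, empCDF n x (u i) = empCDF n y (u i) := fun i => by simp only [empCDF, hyx]
  refine sSup_le_sSup ?_
  rintro _ ⟨i, hi, rfl⟩
  refine ⟨u i, ?_, ?_⟩
  · simpa only [Set.mem_ofPred_eq, hGF] using hi
  · simp only [hemp, hGF]

/-- If the samples are coupled so that, at every atom, `X` and `Y` lie on the same side, then the
discrete statistic of `Y` is stochastically dominated by the continuous statistic of `X`. -/
lemma measure_lt_Tdisc_le_of_coupling {Ω : Type*} [MeasurableSpace Ω] (P : Measure Ω)
    [IsProbabilityMeasure P] {X Y : Ω → ℝ} (hX : Measurable X) (hY : Measurable Y)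
    {n m : ℕ} {ν : ℝ} {u : Fin m → ℝ} {G F : ℝ → ℝ}
    (hGF : ∀ i, F (u i) = G (u i)) (hXY : ∀ i ω, X ω ≤ u i ↔ Y ω ≤ u i) (r : EReal) :
    (Measure.pi fun _ : Fin n => P.map Y) {y | r < Tdisc n m ν u G y}
      ≤ (Measure.pi fun _ : Fin n => P.map X) {x | r < Tcont n ν F x} := by
  have := Measure.isProbabilityMeasure_map (μ := P) hX.aemeasurable
  have := Measure.isProbabilityMeasure_map (μ := P) hY.aemeasurable
  have hmX := measurePreserving_pi (fun _ : Fin n => P) (fun _ => P.map X)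
    fun _ => hX.measurePreserving P
  have hmY := measurePreserving_pi (fun _ : Fin n => P) (fun _ => P.map Y)
    fun _ => hY.measurePreserving P
  rw [← hmY.measure_preimage (measurableSet_lt_Tdisc n m ν u G r).nullMeasurableSet, ← hmX.map_eq]
  refine le_trans (measure_mono fun ω hω => ?_) (Measure.le_map_apply hmX.measurable.aemeasurable _)
  exact lt_of_lt_of_le hω (Tdisc_le_Tcont hGF fun i j => hXY i (ω j))

/-- Stochastic dominance (Appendix of the paper): the DW statistic of an i.i.d. sample
from a finitely supported distribution `G = Σ p_i δ_{u_i}` is stochastically dominated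
by the DW statistic of an i.i.d. sample from a suitable continuous distribution `μ`. -/
theorem dw_stochastic_dominance
    (n m : ℕ) (hn : 1 ≤ n) (hm : 1 ≤ m) (ν : ℝ) (hν : 0 ≤ ν)
    (u : Fin m → ℝ) (hu : StrictMono u)
    (p : Fin m → ℝ) (hp : ∀ i, 0 < p i) (hsum : ∑ i, p i = 1)
    (G : Measure ℝ) [IsProbabilityMeasure G]
    (hG : G = ∑ i : Fin m, ENNReal.ofReal (p i) • Measure.dirac (u i))
    (Gcdf : ℝ → ℝ)
    (hGcdf : ∀ t, Gcdf t = ∑ i ∈ Finset.univ.filter fun i : Fin m => u i ≤ t, p i) :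
    ∃ μ : Measure ℝ, IsProbabilityMeasure μ ∧
      Continuous (fun t => (μ (Set.Iic t)).toReal) ∧
      ∀ r : ℝ,
        (Measure.pi fun _ : Fin n => G) {y | (r : EReal) < Tdisc n m ν u Gcdf y}
          ≤ (Measure.pi fun _ : Fin n => μ)
              {x | (r : EReal) < Tcont n ν (fun t => (μ (Set.Iic t)).toReal) x} := by
  choose ε hε hgap using exists_gap_of_strictMono hu
  let Q : Measure (Fin m) := ∑ i : Fin m, ENNReal.ofReal (p i) • Measure.dirac i
  have hQ : IsProbabilityMeasure Q := by
    constructor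
    simp only [Q, Measure.finsetSum_apply, Measure.smul_apply, measure_univ, smul_eq_mul, mul_one]
    rw [← ENNReal.ofReal_sum_of_nonneg fun i _ => (hp i).le, hsum, ENNReal.ofReal_one]
  let P : Measure (Fin m × unitInterval) := Q.prod volume
  let X : Fin m × unitInterval → ℝ := fun ω => u ω.1 - ε ω.1 * ω.2
  let Y : Fin m × unitInterval → ℝ := fun ω => u ω.1
  have hY : Measurable Y := (measurable_of_countable u).comp measurable_fst
  have hX : Measurable X := hY.sub
    (((measurable_of_countable ε).comp measurable_fst).mul
      (measurable_subtype_coe.comp measurable_snd))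
  have hXY : ∀ i ω, X ω ≤ u i ↔ Y ω ≤ u i := by
    rintro i ⟨k, s⟩
    have hs0 : 0 ≤ ε k * s := mul_nonneg (hε k).le s.2.1
    have hs1 : ε k * s ≤ ε k := mul_le_of_le_one_right (hε k).le s.2.2
    simp only [X, Y]
    refine ⟨fun h => ?_, fun h => by linarith⟩
    by_contra! hlt
    linarith [hgap k i (hu.lt_iff_lt.1 hlt)]
  have hPY : P.map Y = G := by
    have hcomp : P.map Y = Q.map u := by
      rw [show Y = u ∘ Prod.fst from rfl,
        ← Measure.map_map (measurable_of_countable u) measurable_fst, ← Measure.fst, Measure.fst_prod]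
    rw [hcomp, hG, Measure.map_finset_sum (measurable_of_countable u).aemeasurable]
    simp [Measure.map_dirac]
  have hprob : IsProbabilityMeasure (P.map X) :=
    Measure.isProbabilityMeasure_map hX.aemeasurable
  have hnull : NullSingletonClass (P.map X) := by
    refine ⟨fun t => ?_⟩
    rw [Measure.map_apply hX (measurableSet_singleton t)]
    refine Measure.measure_prod_null_of_ae_null (hX (measurableSet_singleton t))
      (Filter.Eventually.of_forall fun k => Set.Subsingleton.measure_zero ?_ _)
    intro s hs s' hs'
    have h : u k - ε k * s = t := hs
    have h' : u k - ε k * s' = t := hs'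
    exact Subtype.ext (mul_left_cancel₀ (hε k).ne' (by linarith))
  have hF : ∀ i, (P.map X (Set.Iic (u i))).toReal = Gcdf (u i) := by
    intro i
    have hXG : P.map X (Set.Iic (u i)) = G (Set.Iic (u i)) := by
      rw [← hPY, Measure.map_apply hX measurableSet_Iic, Measure.map_apply hY measurableSet_Iic]
      exact congrArg P (Set.ext (hXY i))
    rw [hXG, hG, hGcdf]
    simp only [Measure.finsetSum_apply, Measure.smul_apply, smul_eq_mul,
      Measure.dirac_apply' _ measurableSet_Iic, Set.indicator_apply, Set.mem_Iic, Pi.one_apply,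
      mul_ite, mul_one, mul_zero]
    rw [← Finset.sum_filter, ← ENNReal.ofReal_sum_of_nonneg fun i _ => (hp i).le,
      ENNReal.toReal_ofReal (Finset.sum_nonneg fun i _ => (hp i).le)]
  refine ⟨P.map X, hprob, continuous_measure_Iic_toReal _, fun r => ?_⟩
  rw [← hPY]
  exact measure_lt_Tdisc_le_of_coupling P hX hY hF hXY r
end
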